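/- Let k be a finite field and let C be an idempotent-complete, k-linear triangulated category with shift functor T in which all Hom-spaces are finite. Let t : Y → Z → X → TY be a distinguished triangle with X, Y, Z all indecomposable. Then the ring homomorphism End(t) → End(X) given by projection onto the X-component induces an injective homomorphism End(t)/rad End(t) → End(X)/rad End(X); consequently d(t) := dim_k(End(t)/rad End(t)) divides d(X) := dim_k(End(X)/rad End(X)), and likewise d(t) divides d(Y) and d(Z). -/

import Mathlib

open CategoryTheory CategoryTheory.Limits CategoryTheory.Pretriangulated

universe w v u

namespace HallTri

/-- The Jacobson radical of a `k`-algebra `A`, as a `k`-submodule of `A`. -/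
def radSubmodule (k : Type) [Field k] (A : Type w) [Ring A] [Algebra k A] :
    Submodule k A where
  carrier := {x | x ∈ TwoSidedIdeal.jacobson (⊥ : TwoSidedIdeal A)}
  add_mem' := by
    intro a b ha hb
    show a + b ∈ TwoSidedIdeal.jacobson (⊥ : TwoSidedIdeal A)
    exact add_mem ha hb
  zero_mem' := by
    show (0 : A) ∈ TwoSidedIdeal.jacobson (⊥ : TwoSidedIdeal A)
    exact zero_mem _
  smul_mem' := by
    intro a x hx
    show a • x ∈ TwoSidedIdeal.jacobson (⊥ : TwoSidedIdeal A)
    rw [Algebra.smul_def]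
    exact TwoSidedIdeal.mul_mem_left _ _ _ hx

/-- `dk k A` is the `k`-dimension of `A / rad A`, for a `k`-algebra `A`. -/
noncomputable def dk (k : Type) [Field k] (A : Type w) [Ring A] [Algebra k A] : ℕ :=
  Module.finrank k (A ⧸ radSubmodule k A)

variable (k : Type) [Field k] [Fintype k]
variable {C : Type u} [Category.{v} C] [HasZeroObject C] [HasShift C ℤ] [Preadditive C]
  [∀ n : ℤ, (shiftFunctor C n).Additive] [Pretriangulated C] [IsTriangulated C]
  [Linear k C] [(shiftFunctor C (1 : ℤ)).Linear k]
  [IsIdempotentComplete C] [HasBinaryBiproducts C]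

/-- The endomorphism algebra of a triangle `t : Y →f Z →g X →h TY`: the subalgebra of
`End Y × End Z × End X` of triples `(η, ζ, ξ)` with `ζ∘f = f∘η`, `ξ∘g = g∘ζ` and
`(Tη)∘h = h∘ξ`. -/
def TriangleEnd {X Y Z : C} (f : Y ⟶ Z) (g : Z ⟶ X) (h : X ⟶ Y⟦(1 : ℤ)⟧) :
    Subalgebra k (End Y × End Z × End X) where
  carrier := {e | f ≫ e.2.1 = e.1 ≫ f ∧ g ≫ e.2.2 = e.2.1 ≫ g ∧
    h ≫ (shiftFunctor C (1 : ℤ)).map e.1 = e.2.2 ≫ h}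
  algebraMap_mem' r :=
    ⟨by
      show f ≫ (algebraMap k (End Z) r : End Z) = (algebraMap k (End Y) r : End Y) ≫ f
      rw [Algebra.algebraMap_eq_smul_one, Algebra.algebraMap_eq_smul_one]
      show f ≫ (r • 𝟙 Z) = (r • 𝟙 Y) ≫ f
      simp,
     by
      show g ≫ (algebraMap k (End X) r : End X) = (algebraMap k (End Z) r : End Z) ≫ g
      rw [Algebra.algebraMap_eq_smul_one, Algebra.algebraMap_eq_smul_one]
      show g ≫ (r • 𝟙 X) = (r • 𝟙 Z) ≫ g
      simp,
     by
      show h ≫ (shiftFunctor C (1 : ℤ)).map (algebraMap k (End Y) r) =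
        (algebraMap k (End X) r : End X) ≫ h
      rw [Algebra.algebraMap_eq_smul_one, Algebra.algebraMap_eq_smul_one]
      show h ≫ (shiftFunctor C (1 : ℤ)).map (r • 𝟙 Y) = (r • 𝟙 X) ≫ h
      rw [Functor.map_smul]
      simp⟩
  mul_mem' := by
    rintro a b ⟨ha1, ha2, ha3⟩ ⟨hb1, hb2, hb3⟩
    refine ⟨?_, ?_, ?_⟩
    · show f ≫ b.2.1 ≫ a.2.1 = (b.1 ≫ a.1) ≫ f
      rw [← Category.assoc, hb1, Category.assoc, ha1, ← Category.assoc]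
    · show g ≫ b.2.2 ≫ a.2.2 = (b.2.1 ≫ a.2.1) ≫ g
      rw [← Category.assoc, hb2, Category.assoc, ha2, ← Category.assoc]
    · show h ≫ (shiftFunctor C (1 : ℤ)).map (b.1 ≫ a.1) = (b.2.2 ≫ a.2.2) ≫ h
      rw [Functor.map_comp, ← Category.assoc, hb3, Category.assoc, ha3,
        ← Category.assoc]
  add_mem' := by
    rintro a b ⟨ha1, ha2, ha3⟩ ⟨hb1, hb2, hb3⟩
    refine ⟨?_, ?_, ?_⟩
    · show f ≫ (a.2.1 + b.2.1) = (a.1 + b.1) ≫ f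
      rw [Preadditive.comp_add, Preadditive.add_comp, ha1, hb1]
    · show g ≫ (a.2.2 + b.2.2) = (a.2.1 + b.2.1) ≫ g
      rw [Preadditive.comp_add, Preadditive.add_comp, ha2, hb2]
    · show h ≫ (shiftFunctor C (1 : ℤ)).map (a.1 + b.1) = (a.2.2 + b.2.2) ≫ h
      rw [Functor.map_add, Preadditive.comp_add, Preadditive.add_comp, ha3, hb3]

section Algebra

lemma exists_pow_idem {A : Type*} [Monoid A] [Finite A] (x : A) :
    ∃ n : ℕ, 0 < n ∧ x ^ n * x ^ n = x ^ n := by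
  obtain ⟨m, n, hmn, h⟩ : ∃ m n : ℕ, m < n ∧ x ^ m = x ^ n := by
    obtain ⟨a, b, hab, h⟩ := Finite.exists_ne_map_eq_of_infinite (fun n : ℕ => x ^ n)
    rcases lt_or_gt_of_ne hab with h1 | h1
    · exact ⟨a, b, h1, h⟩
    · exact ⟨b, a, h1, h.symm⟩
  obtain ⟨p, rfl⟩ := Nat.exists_eq_add_of_lt hmn
  have key : ∀ j i : ℕ, x ^ (m + i + j * (p + 1)) = x ^ (m + i) := by
    intro j
    induction j with
    | zero => simp
    | succ j ih =>
      intro i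
      have e : m + i + (j + 1) * (p + 1) = (m + p + 1) + (i + j * (p + 1)) := by ring
      rw [e, pow_add, ← h, ← pow_add, ← add_assoc, ih]
  refine ⟨(m + 1) * (p + 1), by positivity, ?_⟩
  rw [← pow_add]
  obtain ⟨i, hi⟩ : ∃ i, (m + 1) * (p + 1) = m + i := ⟨m * p + p + 1, by ring⟩
  have := key (m + 1) i
  rw [← hi] at this
  exact this

lemma nil_or_unit {A : Type*} [Ring A] [Finite A]
    (h : ∀ e : A, e * e = e → e = 0 ∨ e = 1) (x : A) : IsNilpotent x ∨ IsUnit x := by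
  obtain ⟨n, hn, hx⟩ := exists_pow_idem x
  rcases h _ hx with h0 | h1
  · exact Or.inl ⟨n, h0⟩
  · exact Or.inr (IsUnit.of_pow_eq_one h1 hn.ne')

lemma mem_jac_iff {A : Type*} [Ring A] [Finite A] [Nontrivial A]
    (h : ∀ x : A, IsNilpotent x ∨ IsUnit x) (x : A) :
    x ∈ TwoSidedIdeal.jacobson (⊥ : TwoSidedIdeal A) ↔ ¬ IsUnit x := by
  rw [TwoSidedIdeal.mem_jacobson_iff]
  constructor
  · rintro hx ⟨u, rfl⟩
    obtain ⟨z, hz⟩ := hx (-(↑u⁻¹ : A))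
    rw [TwoSidedIdeal.mem_bot] at hz
    simp [mul_assoc] at hz
  · intro hx y
    have h1 : IsNilpotent (y * x) := by
      rcases h (y * x) with h2 | h2
      · exact h2
      · exfalso
        obtain ⟨u, hu⟩ := h2
        apply hx
        have : (↑u⁻¹ * y) * x = 1 := by rw [mul_assoc, ← hu]; simp
        exact IsUnit.of_mul_eq_one_right _ this
    obtain ⟨u, hu⟩ := h1.isUnit_add_one
    refine ⟨↑u⁻¹, ?_⟩
    rw [TwoSidedIdeal.mem_bot]
    have : (↑u⁻¹ : A) * (y * x + 1) = 1 := by rw [← hu]; simp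
    rw [mul_add, mul_one, ← mul_assoc] at this
    rw [this, sub_self]

variable (k : Type) [Field k]

lemma jac_iff {A : Type*} {B : Type*} [Ring A] [Ring B] [Algebra k A] [Algebra k B]
    [Finite A] [Finite B] [Nontrivial A] [Nontrivial B] (φ : A →ₐ[k] B)
    (hA : ∀ x : A, IsNilpotent x ∨ IsUnit x) (hB : ∀ x : B, IsNilpotent x ∨ IsUnit x) (a : A) :
    a ∈ TwoSidedIdeal.jacobson (⊥ : TwoSidedIdeal A) ↔
      φ a ∈ TwoSidedIdeal.jacobson (⊥ : TwoSidedIdeal B) := by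
  rw [mem_jac_iff hA, mem_jac_iff hB, not_iff_not]
  constructor
  · intro h
    exact h.map φ
  · intro h
    rcases hA a with h1 | h1
    · exact absurd h (h1.map φ).not_isUnit
    · exact h1

lemma dk_eq (A : Type w) [Ring A] [Algebra k A] :
    dk k A = Module.finrank k (A ⧸ (Ideal.jacobson (⊥ : Ideal A))) := by
  have : radSubmodule k A = (Ideal.jacobson (⊥ : Ideal A)).restrictScalars k := by
    ext x
    show x ∈ TwoSidedIdeal.jacobson (⊥ : TwoSidedIdeal A) ↔ x ∈ Ideal.jacobson (⊥ : Ideal A)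
    rw [TwoSidedIdeal.mem_jacobson_iff, Ideal.mem_jacobson_iff]
    simp [TwoSidedIdeal.mem_bot]
  unfold dk
  rw [this]
  exact (Submodule.Quotient.restrictScalarsEquiv k (Ideal.jacobson (⊥ : Ideal A))).finrank_eq

lemma dk_dvd {A : Type*} {B : Type*} [Ring A] [Ring B] [Algebra k A] [Algebra k B]
    [Finite A] [Finite B] [Nontrivial A] [Nontrivial B] (φ : A →ₐ[k] B)
    (hA : ∀ x : A, IsNilpotent x ∨ IsUnit x) (hB : ∀ x : B, IsNilpotent x ∨ IsUnit x) :
    dk k A ∣ dk k B := by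
  have e : ∀ (R : Type _) [Ring R] (x : R), x ∈ Ideal.jacobson (⊥ : Ideal R) ↔
      x ∈ TwoSidedIdeal.jacobson (⊥ : TwoSidedIdeal R) := by
    intro R _ x
    rw [TwoSidedIdeal.mem_jacobson_iff, Ideal.mem_jacobson_iff]
    simp [TwoSidedIdeal.mem_bot]
  have e' : ∀ (R : Type _) [Ring R] (x : R), x ∈ Ideal.jacobson (⊥ : Ideal R) ↔
      x ∈ TwoSidedIdeal.jacobson (⊥ : TwoSidedIdeal R) := by
    intro R _ x
    rw [TwoSidedIdeal.mem_jacobson_iff, Ideal.mem_jacobson_iff]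
    simp [TwoSidedIdeal.mem_bot]
  rw [dk_eq, dk_eq]
  have hne : Ideal.jacobson (⊥ : Ideal A) ≠ ⊤ := by
    rw [Ideal.ne_top_iff_one, e, mem_jac_iff hA]
    simp
  have : Nontrivial (A ⧸ Ideal.jacobson (⊥ : Ideal A)) := Ideal.Quotient.nontrivial_iff.2 hne
  let ψ : (A ⧸ Ideal.jacobson (⊥ : Ideal A)) →+* (B ⧸ Ideal.jacobson (⊥ : Ideal B)) :=
    Ideal.Quotient.lift _ ((Ideal.Quotient.mk _).comp φ.toRingHom) (by
      intro a ha
      rw [e, jac_iff k φ hA hB, ← e'] at ha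
      exact Ideal.Quotient.eq_zero_iff_mem.2 ha)
  have hψ : ∀ a, ψ (Ideal.Quotient.mk _ a) = Ideal.Quotient.mk _ (φ a) := fun a => rfl
  have hu : ∀ a : A ⧸ Ideal.jacobson (⊥ : Ideal A), IsUnit a ∨ a = 0 := by
    intro a
    obtain ⟨a, rfl⟩ := Ideal.Quotient.mk_surjective a
    by_cases h : IsUnit a
    · exact Or.inl (h.map _)
    · right
      rw [Ideal.Quotient.eq_zero_iff_mem, e, mem_jac_iff hA]
      exact h
  let := DivisionRing.ofIsUnitOrEqZero hu
  let : Module (A ⧸ Ideal.jacobson (⊥ : Ideal A)) (B ⧸ Ideal.jacobson (⊥ : Ideal B)) :=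
    Module.compHom _ ψ
  have : IsScalarTower k (A ⧸ Ideal.jacobson (⊥ : Ideal A))
      (B ⧸ Ideal.jacobson (⊥ : Ideal B)) := by
    refine ⟨fun r a b => ?_⟩
    obtain ⟨a, rfl⟩ := Ideal.Quotient.mk_surjective a
    obtain ⟨b, rfl⟩ := Ideal.Quotient.mk_surjective b
    show Ideal.Quotient.mk _ (φ (r • a) * b) = Ideal.Quotient.mk _ (r • (φ a * b))
    rw [map_smul, smul_mul_assoc]
  exact Module.finrank_dvd_finrank_right k (A ⧸ Ideal.jacobson (⊥ : Ideal A))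
    (B ⧸ Ideal.jacobson (⊥ : Ideal B))

end Algebra

lemma indec_idem_aux {C : Type u} [Category.{v} C] [Preadditive C]
    [IsIdempotentComplete C] [HasBinaryBiproducts C] {X : C} (hX : Indecomposable X)
    (e : X ⟶ X) (he1 : e ≫ e = e) : e = 0 ∨ e = 𝟙 X := by
  obtain ⟨Y, i, p, hip, hpi⟩ := IsIdempotentComplete.idempotents_split X e he1
  have he2 : (𝟙 X - e) ≫ (𝟙 X - e) = 𝟙 X - e := by
    simp [he1]
  obtain ⟨Z, j, q, hjq, hqj⟩ := IsIdempotentComplete.idempotents_split X _ he2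
  have hiq : i ≫ q = 0 := by
    have : i ≫ q = i ≫ (p ≫ i) ≫ (q ≫ j) ≫ q := by
      simp only [Category.assoc, hjq, Category.comp_id]
      rw [reassoc_of% hip]
    rw [this, hpi, hqj]
    simp [reassoc_of% he1]
  have hjp : j ≫ p = 0 := by
    have : j ≫ p = j ≫ (q ≫ j) ≫ (p ≫ i) ≫ p := by
      simp only [Category.assoc, hip, Category.comp_id]
      rw [reassoc_of% hjq]
    rw [this, hpi, hqj]
    simp [reassoc_of% he1]
  let iso : X ≅ Y ⊞ Z :=
    { hom := biprod.lift p q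
      inv := biprod.desc i j
      hom_inv_id := by rw [biprod.lift_desc, hpi, hqj]; simp
      inv_hom_id := by
        apply biprod.hom_ext' <;> apply biprod.hom_ext <;> simp [hip, hjq, hiq, hjp] }
  rcases hX.2 Y Z iso with h | h
  · left
    rw [← hpi, h.eq_of_tgt p 0, zero_comp]
  · right
    rw [h.eq_of_tgt q 0, zero_comp] at hqj
    exact (sub_eq_zero.1 hqj.symm).symm

lemma indec_idem {C : Type u} [Category.{v} C] [Preadditive C]
    [IsIdempotentComplete C] [HasBinaryBiproducts C] {X : C} (hX : Indecomposable X)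
    (e : End X) (he : e * e = e) : e = 0 ∨ e = 1 :=
  indec_idem_aux hX e he

/-- The projection `End(t) → End(X)` induces an injective ring homomorphism
`End(t)/rad End(t) → End(X)/rad End(X)`; consequently `d(t)` divides each of `d(X)`,
`d(Y)` and `d(Z)`. -/
theorem triangleEnd_radical_quotient_embeds (hHom : ∀ A B : C, Finite (A ⟶ B))
    (X Y Z : C) (f : Y ⟶ Z) (g : Z ⟶ X) (h : X ⟶ Y⟦(1 : ℤ)⟧)
    (ht : Triangle.mk f g h ∈ distTriang C)
    (hX : Indecomposable X) (hY : Indecomposable Y) (hZ : Indecomposable Z) :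
    (∀ e : TriangleEnd k f g h,
      e ∈ TwoSidedIdeal.jacobson (⊥ : TwoSidedIdeal (TriangleEnd k f g h)) ↔
        (e : End Y × End Z × End X).2.2 ∈
          TwoSidedIdeal.jacobson (⊥ : TwoSidedIdeal (End X))) ∧
    dk k (TriangleEnd k f g h) ∣ dk k (End X) ∧
    dk k (TriangleEnd k f g h) ∣ dk k (End Y) ∧
    dk k (TriangleEnd k f g h) ∣ dk k (End Z) := by
  have hX0 := hX.1
  have hY0 := hY.1
  have hZ0 := hZ.1
  have no12 : ¬ (f = 0 ∧ g = 0) := by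
    rintro ⟨h1, h2⟩
    have : Mono g := Triangle.mono₂ _ ht h1
    exact hZ0 ((IsZero.iff_id_eq_zero Z).2 (by rw [← cancel_mono g]; simp [h2]))
  have no23 : ¬ (g = 0 ∧ h = 0) := by
    rintro ⟨h1, h2⟩
    have : Epi g := Triangle.epi₂ _ ht h2
    exact hX0 ((IsZero.iff_id_eq_zero X).2 (by rw [← cancel_epi g]; simp [h1]))
  have no13 : ¬ (f = 0 ∧ h = 0) := by
    rintro ⟨h1, h2⟩
    have : Mono f := Triangle.mono₁ _ ht h2
    exact hY0 ((IsZero.iff_id_eq_zero Y).2 (by rw [← cancel_mono f]; simp [h1]))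
  have : Finite (End X) := hHom X X
  have : Finite (End Y) := hHom Y Y
  have : Finite (End Z) := hHom Z Z
  have nt : ∀ W : C, ¬ IsZero W → Nontrivial (End W) := fun W hW =>
    ⟨1, 0, fun h01 => hW ((IsZero.iff_id_eq_zero W).2 h01)⟩
  have := nt X hX0
  have := nt Y hY0
  have := nt Z hZ0
  have idem : ∀ e : TriangleEnd k f g h, e * e = e → e = 0 ∨ e = 1 := by
    rintro ⟨⟨η, ζ, ξ⟩, h1, h2, h3⟩ he
    have he' : (η * η, ζ * ζ, ξ * ξ) = (η, ζ, ξ) := congrArg Subtype.val he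
    simp only [Prod.mk.injEq] at he'
    obtain ⟨a1, a2, a3⟩ := he'
    change f ≫ ζ = η ≫ f at h1
    change g ≫ ξ = ζ ≫ g at h2
    change h ≫ (shiftFunctor C (1 : ℤ)).map η = ξ ≫ h at h3
    have m0 : (shiftFunctor C (1 : ℤ)).map (0 : End Y) = 0 :=
      Functor.map_zero _ _ _
    have m1 : (shiftFunctor C (1 : ℤ)).map (1 : End Y) = 𝟙 _ :=
      CategoryTheory.Functor.map_id _ _
    have z : ∀ {W V : C} (r : W ⟶ V), r ≫ (0 : End V) = 0 := fun r => comp_zero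
    have z' : ∀ {W V : C} (r : W ⟶ V), (0 : End W) ≫ r = 0 := fun r => zero_comp
    have o : ∀ {W V : C} (r : W ⟶ V), r ≫ (1 : End V) = r := fun r => Category.comp_id _
    have o' : ∀ {W V : C} (r : W ⟶ V), (1 : End W) ≫ r = r := fun r => Category.id_comp _
    rcases indec_idem hY η a1 with rfl | rfl <;>
    rcases indec_idem hZ ζ a2 with rfl | rfl <;>
    rcases indec_idem hX ξ a3 with rfl | rfl <;>
    simp only [m0, m1, z, z', o, o', Category.comp_id] at h1 h2 h3
    · exact Or.inl rfl
    · exact (no23 ⟨h2, h3.symm⟩).elim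
    · exact (no12 ⟨h1, h2.symm⟩).elim
    · exact (no13 ⟨h1, h3.symm⟩).elim
    · exact (no13 ⟨h1.symm, h3⟩).elim
    · exact (no12 ⟨h1.symm, h2⟩).elim
    · exact (no23 ⟨h2.symm, h3⟩).elim
    · exact Or.inr rfl
  have hT := nil_or_unit idem
  have hXn := nil_or_unit (indec_idem hX)
  have hYn := nil_or_unit (indec_idem hY)
  have hZn := nil_or_unit (indec_idem hZ)
  let v := (TriangleEnd k f g h).val
  let pX : TriangleEnd k f g h →ₐ[k] End X :=
    ((AlgHom.snd k (End Z) (End X)).comp (AlgHom.snd k (End Y) (End Z × End X))).comp v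
  let pZ : TriangleEnd k f g h →ₐ[k] End Z :=
    ((AlgHom.fst k (End Z) (End X)).comp (AlgHom.snd k (End Y) (End Z × End X))).comp v
  let pY : TriangleEnd k f g h →ₐ[k] End Y :=
    (AlgHom.fst k (End Y) (End Z × End X)).comp v
  exact ⟨fun e => jac_iff k pX hT hXn e, dk_dvd k pX hT hXn, dk_dvd k pY hT hYn,
    dk_dvd k pZ hT hZn⟩

end HallTri
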